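/- arXiv:1103.2169 — 2 statements merged into one kernel-verified Lean document; each statement's English description precedes it below -/
import Mathlib

section
/- Let k be a natural number and let A ⊆ {1,…,2g} be a subset of cardinality 2(g−k) which is NOT pairing-closed. Then in Λ: θ^k · e_A = 0. -/
/-!
Exterior algebra model of `H^*(Pic C; ℚ)` for a genus `g` curve: `Λ` is the
exterior algebra of `ℚ^{2g}`, with basis vectors `e i`; the index `i ∈ {1,…,g}`
corresponds to `Fin.castAdd g i` and `g+i` to `Fin.natAdd g i`.
-/

noncomputable section

/-- The basis vector `e_i` of the exterior algebra `Λ = ⋀ ℚ^{2g}`. -/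
def eVec (g : ℕ) (i : Fin (g + g)) : ExteriorAlgebra ℚ (Fin (g + g) → ℚ) :=
  ExteriorAlgebra.ι ℚ (Pi.single i 1)

/-- For `A = {i_1 < ⋯ < i_r} ⊆ {1,…,2g}`, the basis monomial
`e_A = e_{i_1} ∧ ⋯ ∧ e_{i_r}`. -/
def eMon (g : ℕ) (A : Finset (Fin (g + g))) : ExteriorAlgebra ℚ (Fin (g + g) → ℚ) :=
  ((A.sort (· ≤ ·)).map (eVec g)).prod

/-- `A ⊆ {1,…,2g}` is pairing-closed if for every `i ∈ {1,…,g}`,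
`i ∈ A ↔ g + i ∈ A`. -/
def PairingClosed (g : ℕ) (A : Finset (Fin (g + g))) : Prop :=
  ∀ i : Fin g, Fin.castAdd g i ∈ A ↔ Fin.natAdd g i ∈ A

/-- The theta class `θ = Σ_{i=1}^g e_i ∧ e_{g+i}`. -/
def theta (g : ℕ) : ExteriorAlgebra ℚ (Fin (g + g) → ℚ) :=
  ∑ i : Fin g, eVec g (Fin.castAdd g i) * eVec g (Fin.natAdd g i)

theorem Commute.sum_pow_eq_zero_of_sq_eq_zero {ι R : Type*} [Semiring R] {w : ι → R}
    (hcomm : ∀ i j, Commute (w i) (w j)) (hsq : ∀ i, w i ^ 2 = 0) (s : Finset ι) {n : ℕ}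
    (hn : s.card < n) : (∑ i ∈ s, w i) ^ n = 0 := by
  classical
  induction s using Finset.induction_on generalizing n with
  | empty => simp only [Finset.sum_empty, Finset.card_empty] at hn ⊢; exact zero_pow hn.ne'
  | insert a s ha ih =>
    rw [Finset.card_insert_of_notMem ha] at hn
    rw [Finset.sum_insert ha]
    exact (Commute.sum_right _ _ _ fun j _ => hcomm a j).add_pow_eq_zero_of_add_le_succ_of_pow_eq_zero
      (hsq a) (ih (Nat.lt_succ_self _)) (by omega)

theorem eVec_mul_self (g : ℕ) (i : Fin (g + g)) : eVec g i * eVec g i = 0 :=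
  ExteriorAlgebra.ι_sq_zero _

theorem eVec_mul_swap (g : ℕ) (i j : Fin (g + g)) :
    eVec g i * eVec g j = -(eVec g j * eVec g i) :=
  eq_neg_of_add_eq_zero_left (ExteriorAlgebra.ι_add_mul_swap _ _)

theorem commute_eVec_mul_eVec (g : ℕ) (i j l : Fin (g + g)) :
    Commute (eVec g i * eVec g j) (eVec g l) := by
  unfold Commute SemiconjBy
  rw [mul_assoc, eVec_mul_swap g j l, mul_neg, ← mul_assoc, eVec_mul_swap g i l, neg_mul, neg_neg,
    mul_assoc]

theorem eVec_mul_prod_eq_zero (g : ℕ) {j : Fin (g + g)} {l : List (Fin (g + g))} (hj : j ∈ l) :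
    eVec g j * (l.map (eVec g)).prod = 0 := by
  induction l with
  | nil => simp at hj
  | cons a l ih =>
    rw [List.map_cons, List.prod_cons, ← mul_assoc]
    rcases List.mem_cons.mp hj with rfl | h
    · rw [eVec_mul_self, zero_mul]
    · rw [eVec_mul_swap, neg_mul, mul_assoc, ih h, mul_zero, neg_zero]

theorem eVec_mul_eMon_eq_zero (g : ℕ) {j : Fin (g + g)} {A : Finset (Fin (g + g))} (hj : j ∈ A) :
    eVec g j * eMon g A = 0 :=
  eVec_mul_prod_eq_zero g ((Finset.mem_sort _).mpr hj)

theorem eVec_mul_eVec_mul_eMon_eq_zero (g : ℕ) {i j : Fin (g + g)} {A : Finset (Fin (g + g))}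
    (h : i ∈ A ∨ j ∈ A) : eVec g i * eVec g j * eMon g A = 0 := by
  rcases h with h | h
  · rw [eVec_mul_swap, neg_mul, mul_assoc, eVec_mul_eMon_eq_zero g h, mul_zero, neg_zero]
  · rw [mul_assoc, eVec_mul_eMon_eq_zero g h, mul_zero]

/-- The indices `i` for which neither `i` nor `g + i` lies in `A`. -/
def freePairs (g : ℕ) (A : Finset (Fin (g + g))) : Finset (Fin g) :=
  {i | Fin.castAdd g i ∉ A ∧ Fin.natAdd g i ∉ A}

theorem two_mul_card_freePairs_add_card_lt (g : ℕ) {A : Finset (Fin (g + g))}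
    (hA : ¬ PairingClosed g A) : 2 * (freePairs g A).card + A.card < 2 * g := by
  have hcard : A.card = ∑ i : Fin g, ((if Fin.castAdd g i ∈ A then 1 else 0) +
      (if Fin.natAdd g i ∈ A then 1 else 0)) := by
    rw [Finset.sum_add_distrib, ← Fin.sum_univ_add (fun i => if i ∈ A then 1 else 0)]
    simp
  have hfree : (freePairs g A).card =
      ∑ i : Fin g, if Fin.castAdd g i ∉ A ∧ Fin.natAdd g i ∉ A then 1 else 0 := by
    rw [freePairs, Finset.card_filter]
  have htwo : 2 * g = ∑ _i : Fin g, 2 := by simp [mul_comm]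
  rw [hcard, hfree, htwo, Finset.mul_sum, ← Finset.sum_add_distrib]
  obtain ⟨i, hi⟩ := not_forall.mp hA
  refine Finset.sum_lt_sum (fun j _ => ?_) ⟨i, Finset.mem_univ i, ?_⟩
  · split_ifs <;> simp_all
  · split_ifs <;> simp_all

theorem theta_pow_mul_eMon (g k : ℕ) (A : Finset (Fin (g + g))) :
    theta g ^ k * eMon g A =
      (∑ i ∈ freePairs g A, eVec g (Fin.castAdd g i) * eVec g (Fin.natAdd g i)) ^ k * eMon g A := by
  set σ := ∑ i ∈ freePairs g A, eVec g (Fin.castAdd g i) * eVec g (Fin.natAdd g i) with hσ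
  have hcomm : Commute (theta g) σ :=
    Commute.sum_left _ _ _ fun i _ => Commute.sum_right _ _ _ fun j _ =>
      (commute_eVec_mul_eVec g _ _ _).mul_right (commute_eVec_mul_eVec g _ _ _)
  have hmul : theta g * eMon g A = σ * eMon g A := by
    rw [hσ, theta, Finset.sum_mul, Finset.sum_mul]
    refine (Finset.sum_subset (Finset.subset_univ _) fun i _ hi => ?_).symm
    refine eVec_mul_eVec_mul_eMon_eq_zero g ?_
    simpa [freePairs, or_iff_not_imp_left] using hi
  induction k with
  | zero => simp
  | succ k ih =>
    rw [pow_succ, mul_assoc, hmul, ← mul_assoc, (hcomm.pow_left k).eq, mul_assoc, ih, ← mul_assoc,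
      ← pow_succ']

/-- If `A` has cardinality `2(g−k)` and is not pairing-closed, then `θ^k · e_A = 0`. -/
theorem theta_pow_mul_odd (g : ℕ) (hg : 1 ≤ g) (k : ℕ) (hk : k ≤ g)
    (A : Finset (Fin (g + g))) (hcard : A.card = 2 * (g - k))
    (hA : ¬ PairingClosed g A) :
    theta g ^ k * eMon g A = 0 := by
  have hlt := two_mul_card_freePairs_add_card_lt g hA
  rw [theta_pow_mul_eMon, Commute.sum_pow_eq_zero_of_sq_eq_zero _ _ _ (by omega), zero_mul]
  · exact fun i j => (commute_eVec_mul_eVec g _ _ _).mul_right (commute_eVec_mul_eVec g _ _ _)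
  · intro i
    rw [sq, ← mul_assoc, (commute_eVec_mul_eVec g _ _ _).eq, ← mul_assoc, eVec_mul_self, zero_mul,
      zero_mul]

end
end

section
/- Let R be a commutative integral domain with fraction field K, and let A be a commutative R-algebra equipped with an ℕ-grading A = ⨁_{n≥0} A_n by R-submodules making it a graded R-algebra. Assume: (i) the structure map R → A is an isomorphism of R-modules onto A_0; (ii) A is generated as an R-algebra by A_1; (iii) each A_n is a finitely generated torsion-free R-module; (iv) A ⊗_R K is a 2-dimensional K-vector space. Then A_n = 0 for all n ≥ 2, the product in A of any two elements of A_1 is zero, and A_1 ⊗_R K is 1-dimensional over K. In particular A is the trivial square-zero extension of R by the rank-one torsion-free module A_1. -/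
open TensorProduct

theorem DirectSum.Decomposition.linearIndependent_of_mem_of_injective {ι κ R M : Type*}
    [DecidableEq ι] [CommRing R] [AddCommGroup M] [Module R M] (𝒜 : ι → Submodule R M)
    [DirectSum.Decomposition 𝒜] {d : κ → ι} (hd : Function.Injective d) {v : κ → M}
    (hv : ∀ k, v k ∈ 𝒜 (d k)) (htf : ∀ (k : κ) (r : R), r • v k = 0 → r = 0) :
    LinearIndependent R v := by
  rw [linearIndependent_iff']
  intro s g hg k hk
  have h := congrArg (fun x => (DirectSum.decompose 𝒜 x (d k) : M)) hg
  simp only [DirectSum.decompose_sum, DirectSum.decompose_zero, DirectSum.sum_apply,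
    DirectSum.zero_apply, Submodule.coe_sum, Submodule.coe_zero] at h
  rw [Finset.sum_eq_single_of_mem k hk] at h
  · rw [DirectSum.decompose_of_mem_same 𝒜 ((𝒜 (d k)).smul_mem _ (hv k))] at h
    exact htf k _ h
  · intro j _ hj
    exact DirectSum.decompose_of_mem_ne 𝒜 ((𝒜 (d j)).smul_mem _ (hv j)) (hd.ne hj)

theorem LinearIndependent.card_le_finrank_fractionRing_tensorProduct {ι R M : Type*} [Fintype ι]
    [CommRing R] [IsDomain R] [AddCommGroup M] [Module R M] {v : ι → M}
    (hv : LinearIndependent R v)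
    [Module.Finite (FractionRing R) (FractionRing R ⊗[R] M)] :
    Fintype.card ι ≤ Module.finrank (FractionRing R) (FractionRing R ⊗[R] M) := by
  have : IsLocalizedModule (nonZeroDivisors R) (TensorProduct.mk R (FractionRing R) M 1) :=
    (isLocalizedModule_iff_isBaseChange (nonZeroDivisors R) (FractionRing R) _).mpr
      (TensorProduct.isBaseChange R M (FractionRing R))
  exact (hv.of_isLocalizedModule (FractionRing R) (nonZeroDivisors R)
    (TensorProduct.mk R (FractionRing R) M 1)).fintype_card_le_finrank

/-- If the products of elements of `N` vanish and `N` generates `A`, then `A` is spanned by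
the scalars and `N`. -/
theorem Algebra.exists_algebraMap_add_of_adjoin_eq_top {R A : Type*} [CommRing R] [CommRing A]
    [Algebra R A] {N : Submodule R A} (hgen : Algebra.adjoin R (N : Set A) = ⊤)
    (hmul : ∀ x ∈ N, ∀ y ∈ N, x * y = 0) (a : A) :
    ∃ r : R, ∃ x ∈ N, algebraMap R A r + x = a := by
  have ha : a ∈ Algebra.adjoin R (N : Set A) := hgen ▸ Algebra.mem_top
  induction ha using Algebra.adjoin_induction with
  | mem x hx => exact ⟨0, x, hx, by simp⟩
  | algebraMap r => exact ⟨r, 0, N.zero_mem, by simp⟩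
  | add a b _ _ iha ihb =>
    obtain ⟨r, x, hx, rfl⟩ := iha
    obtain ⟨s, y, hy, rfl⟩ := ihb
    exact ⟨r + s, x + y, N.add_mem hx hy, by rw [map_add]; ring⟩
  | mul a b _ _ iha ihb =>
    obtain ⟨r, x, hx, rfl⟩ := iha
    obtain ⟨s, y, hy, rfl⟩ := ihb
    refine ⟨r * s, r • y + s • x, N.add_mem (N.smul_mem r hy) (N.smul_mem s hx), ?_⟩
    rw [map_mul, Algebra.smul_def, Algebra.smul_def]
    linear_combination -hmul x hx y hy

theorem finrank_fractionRing_tensorProduct_self_prod (R M : Type*) [CommRing R] [IsDomain R]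
    [AddCommGroup M] [Module R M] [Module.Finite R M] :
    Module.finrank (FractionRing R) (FractionRing R ⊗[R] (R × M)) =
      1 + Module.finrank (FractionRing R) (FractionRing R ⊗[R] M) := by
  rw [(TensorProduct.prodRight R (FractionRing R) (FractionRing R) R M).finrank_eq,
    Module.finrank_prod, Module.finrank_baseChange, Module.finrank_self]

/-- Algebraic core of Proposition 5.1: let `R` be an integral domain with fraction
field `K` and `A` a commutative graded `R`-algebra such that (i) `R → A` is an
isomorphism of `R`-modules onto `A_0`, (ii) `A` is generated as an `R`-algebra by
`A_1`, (iii) each `A_n` is a finitely generated torsion-free `R`-module, and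
(iv) `A ⊗_R K` is `2`-dimensional over `K`. Then `A_n = 0` for `n ≥ 2`, the
product of any two elements of `A_1` vanishes, and `A_1 ⊗_R K` is
`1`-dimensional over `K`. -/
theorem graded_algebra_rank_two (R : Type*) [CommRing R] [IsDomain R]
    (A : Type*) [CommRing A] [Algebra R A]
    (𝒜 : ℕ → Submodule R A) [GradedAlgebra 𝒜]
    (h0_inj : Function.Injective (algebraMap R A))
    (h0_surj : ∀ x ∈ 𝒜 0, ∃ r : R, algebraMap R A r = x)
    (hgen : Algebra.adjoin R ((𝒜 1 : Submodule R A) : Set A) = ⊤)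
    (hfg : ∀ n : ℕ, (𝒜 n).FG)
    (htf : ∀ (n : ℕ) (r : R) (x : A), x ∈ 𝒜 n → r • x = 0 → r = 0 ∨ x = 0)
    (hdim : Module.finrank (FractionRing R) (FractionRing R ⊗[R] A) = 2) :
    (∀ n : ℕ, 2 ≤ n → 𝒜 n = ⊥) ∧
    (∀ x ∈ 𝒜 1, ∀ y ∈ 𝒜 1, x * y = 0) ∧
    Module.finrank (FractionRing R) (FractionRing R ⊗[R] (𝒜 1)) = 1 := by
  have hfin : Module.Finite (FractionRing R) (FractionRing R ⊗[R] A) :=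
    Module.finite_of_finrank_pos (by omega)
  have hone : (1 : A) ∈ 𝒜 0 := SetLike.GradedOne.one_mem
  have hvanish : ∀ n : ℕ, 2 ≤ n → 𝒜 n = ⊥ := by
    intro n hn
    by_contra hne
    obtain ⟨y, hy, hy0⟩ := Submodule.exists_mem_ne_zero_of_ne_bot hne
    by_cases h1 : 𝒜 1 = ⊥
    · have hzero : ∀ x ∈ 𝒜 1, x = 0 := (Submodule.eq_bot_iff _).mp h1
      obtain ⟨r, x, hx, hxy⟩ := Algebra.exists_algebraMap_add_of_adjoin_eq_top hgen
        (fun x hx _ _ => by rw [hzero x hx, zero_mul]) y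
      rw [hzero x hx, add_zero] at hxy
      have hy' : y ∈ 𝒜 0 := hxy ▸ SetLike.algebraMap_mem_graded 𝒜 r
      exact hy0 ((DirectSum.decompose_of_mem_same 𝒜 hy).symm.trans
        (DirectSum.decompose_of_mem_ne 𝒜 hy' (by omega)))
    · obtain ⟨x, hx, hx0⟩ := Submodule.exists_mem_ne_zero_of_ne_bot h1
      have hli : LinearIndependent R ![1, x, y] := by
        refine DirectSum.Decomposition.linearIndependent_of_mem_of_injective 𝒜
          (d := ![0, 1, n]) ?_ ?_ ?_
        · intro i j hij
          fin_cases i <;> fin_cases j <;> simp at hij ⊢ <;> omega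
        · intro i
          fin_cases i
          exacts [hone, hx, hy]
        · intro i r hr
          fin_cases i
          · exact h0_inj (by simpa [Algebra.smul_def] using hr)
          · exact (htf 1 r x hx hr).resolve_right hx0
          · exact (htf n r y hy hr).resolve_right hy0
      have := hli.card_le_finrank_fractionRing_tensorProduct
      rw [hdim, Fintype.card_fin] at this
      omega
  have hmul : ∀ x ∈ 𝒜 1, ∀ y ∈ 𝒜 1, x * y = 0 := fun x hx y hy =>
    (Submodule.mem_bot R).mp (hvanish 2 le_rfl ▸ SetLike.mul_mem_graded hx hy)
  refine ⟨hvanish, hmul, ?_⟩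
  have : Module.Finite R (𝒜 1) := Module.Finite.iff_fg.mpr (hfg 1)
  let f : (R × 𝒜 1) →ₗ[R] A := (Algebra.linearMap R A).coprod (𝒜 1).subtype
  have hf : Function.Bijective f := by
    constructor
    · rw [injective_iff_map_eq_zero]
      rintro ⟨r, x, hx⟩ h
      have h : algebraMap R A r + x = 0 := h
      have hx' : x ∈ 𝒜 0 := by
        rw [← neg_eq_of_add_eq_zero_right h]
        exact (𝒜 0).neg_mem (SetLike.algebraMap_mem_graded 𝒜 r)
      have hx0 : x = 0 := (DirectSum.decompose_of_mem_same 𝒜 hx).symm.trans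
        (DirectSum.decompose_of_mem_ne 𝒜 hx' (by omega))
      subst hx0
      rw [add_zero, map_eq_zero_iff _ h0_inj] at h
      subst h
      rfl
    · intro a
      obtain ⟨r, x, hx, h⟩ := Algebra.exists_algebraMap_add_of_adjoin_eq_top hgen hmul a
      exact ⟨(r, ⟨x, hx⟩), h⟩
  have hrank := ((LinearEquiv.ofBijective f hf).baseChange R (FractionRing R) _ _).finrank_eq
  rw [hdim, finrank_fractionRing_tensorProduct_self_prod] at hrank
  omega
end
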